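/- arXiv:2109.00640 — 2 statements merged into one kernel-verified Lean document; each statement's English description precedes it below -/
import Mathlib

section
/- If every countable product of compact separable metrizable spaces is metrizable and separable, then CUC holds. -/
open TopologicalSpace

/-- CUC: every countable union of countable sets is countable. -/
def CUC : Prop :=
  ∀ (Y : Type) (A : ℕ → Set Y), (∀ n, (A n).Countable) → (⋃ n, A n).Countable

/-- The one-point compactification of a countable discrete space embeds in the real line, as the
sequence `1 / (k + 1)` together with its limit. -/
theorem OnePoint.metrizableSpace_of_countable_discrete (A : Type*) [TopologicalSpace A]
    [DiscreteTopology A] [Countable A] : MetrizableSpace (OnePoint A) := by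
  obtain ⟨e, he⟩ := exists_injective_nat A
  let f : OnePoint A → ℝ := fun x => x.elim 0 (fun a => 1 / ((e a : ℝ) + 1))
  have hcont : Continuous f := by
    refine (OnePoint.continuous_iff_from_discrete f).2 ?_
    exact tendsto_one_div_add_atTop_nhds_zero_nat.comp
      (Nat.cofinite_eq_atTop ▸ he.tendsto_cofinite)
  have hpos : ∀ a : A, 0 < f a := fun a => by
    change (0 : ℝ) < 1 / ((e a : ℝ) + 1)
    positivity
  have hinj : Function.Injective f := by
    intro x y hxy
    induction x using OnePoint.rec with
    | infty =>
      induction y using OnePoint.rec with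
      | infty => rfl
      | coe b => exact absurd hxy (hpos b).ne
    | coe a =>
      induction y using OnePoint.rec with
      | infty => exact absurd hxy (hpos a).ne'
      | coe b =>
        have h : (1 : ℝ) / ((e a : ℝ) + 1) = 1 / ((e b : ℝ) + 1) := hxy
        have hab : e a = e b := by simpa using h
        rw [he hab]
  exact (hcont.isClosedEmbedding hinj).isEmbedding.metrizableSpace

/-- If the product of the one-point compactifications of the discrete spaces `A n` is separable,
then the coordinates of a countable dense set exhaust the union of the `A n`. -/
theorem countable_iUnion_of_separableSpace_pi_onePoint {Y : Type*} (A : ℕ → Set Y)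
    [∀ n, TopologicalSpace (A n)] [∀ n, DiscreteTopology (A n)]
    [SeparableSpace (∀ n, OnePoint (A n))] : (⋃ n, A n).Countable := by
  let q : ℕ → ∀ n, OnePoint (A n) := denseSeq _
  let g : ℕ × ℕ → Option Y := fun p => (q p.1 p.2).elim none (fun a => some (a : Y))
  have hg : (Set.range g).Countable := Set.countable_range g
  refine (hg.preimage (Option.some_injective Y)).mono ?_
  intro y hy
  obtain ⟨n, hn⟩ := Set.mem_iUnion.1 hy
  let a : A n := ⟨y, hn⟩
  have hopen : IsOpen {x : ∀ m, OnePoint (A m) | x n = (a : OnePoint (A n))} := by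
    have : IsOpen ({(a : OnePoint (A n))} : Set (OnePoint (A n))) := by
      simpa using OnePoint.isOpenEmbedding_coe.isOpenMap {a} (isOpen_discrete _)
    exact this.preimage (continuous_apply (A := fun m => OnePoint (A m)) n)
  obtain ⟨k, hk⟩ := (denseRange_denseSeq (∀ m, OnePoint (A m))).exists_mem_open hopen
    ⟨Function.update (fun _ => OnePoint.infty) n (a : OnePoint (A n)), by simp⟩
  refine ⟨(k, n), ?_⟩
  have hk' : q k n = (a : OnePoint (A n)) := hk
  simp only [g, hk']
  rfl

/-- If every countable product of compact separable metrizable spaces is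
metrizable and separable, then CUC holds. -/
theorem stmt_16 :
    (∀ (X : ℕ → Type) [∀ n, TopologicalSpace (X n)],
       (∀ n, CompactSpace (X n)) → (∀ n, SeparableSpace (X n)) →
       (∀ n, MetrizableSpace (X n)) →
       MetrizableSpace (∀ n, X n) ∧ SeparableSpace (∀ n, X n)) → CUC := by
  intro h Y A hA
  let : ∀ n, TopologicalSpace (A n) := fun _ => ⊥
  have : ∀ n, DiscreteTopology (A n) := fun _ => ⟨rfl⟩
  have : ∀ n, Countable (A n) := fun n => (hA n).to_subtype
  have : ∀ n, Countable (OnePoint (A n)) := fun n => inferInstanceAs (Countable (Option (A n)))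
  have := (h (fun n => OnePoint (A n)) (fun _ => inferInstance) (fun _ => inferInstance)
    (fun n => OnePoint.metrizableSpace_of_countable_discrete (A n))).2
  exact countable_iUnion_of_separableSpace_pi_onePoint A
end

section
/- CAC_ω is equivalent to the following statement: for every pairwise disjoint family {A_i : i ∈ ℕ} of denumerable sets, there exists a denumerable set H such that for every i ∈ ℕ, the set A_i ∩ H is infinite. -/
/-- CAC_ω: every denumerable family of denumerable sets has a choice function. -/
def CAC_omega : Prop :=
  ∀ (Y : Type) (A : ℕ → Set Y),
    (∀ n, (A n).Countable ∧ (A n).Infinite) →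
    ∃ f : ℕ → Y, ∀ n, f n ∈ A n

/-- The injective tuples of length `k`, written as lists, with entries in `s`. -/
def nodupLists {Y : Type} (s : Set Y) (k : ℕ) : Set (List Y) :=
  {l | l.Nodup ∧ l.length = k ∧ ∀ x ∈ l, x ∈ s}

theorem nodupLists_countable {Y : Type} {s : Set Y} (hs : s.Countable) (k : ℕ) :
    (nodupLists s k).Countable := by
  have := hs.to_subtype
  refine (Set.countable_range (List.map (Subtype.val : s → Y))).mono ?_
  rintro l ⟨-, -, hl⟩
  rw [Set.range_list_map_coe]
  exact hl

theorem nodupLists_succ_infinite {Y : Type} {s : Set Y} (hs : s.Infinite) (k : ℕ) :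
    (nodupLists s (k + 1)).Infinite := by
  intro hfin
  refine hs ((hfin.biUnion fun l _ => l.finite_toSet).subset fun a ha => ?_)
  obtain ⟨t, hts, htk⟩ := (hs.sdiff (Set.finite_singleton a)).exists_subset_card_eq k
  have hat : a ∉ t := fun h => (hts h).2 rfl
  refine Set.mem_biUnion (x := a :: t.toList) ⟨?_, ?_, ?_⟩ List.mem_cons_self
  · exact List.nodup_cons.2 ⟨by simpa using hat, t.nodup_toList⟩
  · simp [htk]
  · intro x hx
    rcases List.mem_cons.1 hx with rfl | hx
    · exact ha
    · exact (hts (Finset.mem_coe.2 (Finset.mem_toList.1 hx))).1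

/-- A set containing injective tuples of every positive length is infinite. -/
theorem infinite_of_nodupLists_nonempty {Y : Type} {s : Set Y}
    (h : ∀ k, (nodupLists s (k + 1)).Nonempty) : s.Infinite := by
  classical
  intro hfin
  obtain ⟨l, hnd, hlen, hl⟩ := h hfin.toFinset.card
  have hsub : l.toFinset ⊆ hfin.toFinset := fun x hx => by
    simpa using hl x (List.mem_toFinset.1 hx)
  have hcard := Finset.card_le_card hsub
  rw [List.toFinset_card_of_nodup hnd, hlen] at hcard
  omega

/-- Choosing an injective tuple of each positive length from each `A n` gives a countable set
meeting every `A n` in an infinite set. -/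
theorem CAC_omega.exists_countable_inter_infinite (hC : CAC_omega) {Y : Type} (A : ℕ → Set Y)
    (hA : ∀ n, (A n).Countable ∧ (A n).Infinite) :
    ∃ H : Set Y, H.Countable ∧ ∀ n, (A n ∩ H).Infinite := by
  obtain ⟨f, hf⟩ := hC (List Y) (fun m => nodupLists (A m.unpair.1) (m.unpair.2 + 1)) fun m =>
    ⟨nodupLists_countable (hA _).1 _, nodupLists_succ_infinite (hA _).2 _⟩
  refine ⟨{x | ∃ m i : ℕ, (f m)[i]? = some x}, ?_, fun n => ?_⟩
  · -- The entries are enumerated by their positions, so no further choice is involved.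
    have hc := (Set.countable_range fun p : ℕ × ℕ => (f p.1)[p.2]?).preimage
      (Option.some_injective Y)
    refine hc.mono ?_
    rintro x ⟨m, i, h⟩
    exact ⟨(m, i), h⟩
  · refine infinite_of_nodupLists_nonempty fun k => ⟨f (Nat.pair n k), ?_⟩
    have h := hf (Nat.pair n k)
    simp only [Nat.unpair_pair] at h
    exact ⟨h.1, h.2.1, fun x hx => ⟨h.2.2 x hx, Nat.pair n k, List.mem_iff_getElem?.1 hx⟩⟩

/-- A countable set meeting every `A n` yields a choice function: take the element of `A n`
that comes first in an enumeration of the set. -/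
theorem exists_choice_of_countable_inter_nonempty {Y : Type} {A : ℕ → Set Y} {H : Set Y}
    (hH : H.Countable) (h : ∀ n, (A n ∩ H).Nonempty) : ∃ f : ℕ → Y, ∀ n, f n ∈ A n := by
  classical
  obtain ⟨e, rfl⟩ := hH.exists_eq_range ((h 0).mono Set.inter_subset_right)
  have hex : ∀ n, ∃ k, e k ∈ A n := fun n => by
    obtain ⟨_, hx, k, rfl⟩ := h n
    exact ⟨k, hx⟩
  exact ⟨fun n => e (Nat.find (hex n)), fun n => Nat.find_spec (hex n)⟩

/-- CAC_ω is equivalent to: for every pairwise disjoint denumerable family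
of denumerable sets there is a denumerable set meeting each member in an infinite set. -/
theorem stmt_18 :
    CAC_omega ↔
      (∀ (Y : Type) (A : ℕ → Set Y),
        (∀ i j, i ≠ j → Disjoint (A i) (A j)) →
        (∀ n, (A n).Countable ∧ (A n).Infinite) →
        ∃ H : Set Y, H.Countable ∧ H.Infinite ∧ ∀ n, (A n ∩ H).Infinite) := by
  constructor
  · intro hC Y A _ hA
    obtain ⟨H, hH, hinf⟩ := hC.exists_countable_inter_infinite A hA
    exact ⟨H, hH, (hinf 0).mono Set.inter_subset_right, hinf⟩
  · intro hD Y A hA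
    have hinj : ∀ n : ℕ, Function.Injective fun y : Y => (n, y) := fun n =>
      Prod.mk_right_injective n
    obtain ⟨H, hH, -, hinf⟩ := hD (ℕ × Y) (fun n => (fun y => (n, y)) '' A n)
      (fun i j hij => by
        rw [Set.disjoint_left]
        rintro _ ⟨y, -, rfl⟩ ⟨z, -, hz⟩
        exact hij (congrArg Prod.fst hz).symm)
      fun n => ⟨(hA n).1.image _, (hA n).2.image (hinj n).injOn⟩
    obtain ⟨g, hg⟩ := exists_choice_of_countable_inter_nonempty hH fun n => (hinf n).nonempty
    refine ⟨fun n => (g n).2, fun n => ?_⟩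
    obtain ⟨y, hy, hgy⟩ := hg n
    have hyg : y = (g n).2 := congrArg Prod.snd hgy
    rwa [hyg] at hy
end
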